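/- arXiv:2411.18782 — 2 statements merged into one kernel-verified Lean document; each statement's English description precedes it below -/
import Mathlib

section
/- Let t, u be coprime positive integers with t < u such that t/u = [b_1, 1, b_2, 1, …, b_m, 1] (a continued fraction with 2m partial quotients alternating b_i and 1, with a_0 = 0) for some positive integers b_1, …, b_m. Then there exists a simple planar connected graph G with exactly t spanning trees and exactly b_2 + ⋯ + b_m + 2 vertices. -/
/-- The number of spanning trees of a simple graph `G`: the number of sets of edges
of `G` forming a tree on the whole vertex set. -/
noncomputable def spanningTreeCount {V : Type} (G : SimpleGraph V) : ℕ :=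
  Nat.card {T : Set (Sym2 V) // T ⊆ G.edgeSet ∧ (SimpleGraph.fromEdgeSet T).IsTree}

/-- `H` is a minor of `G`: there are pairwise disjoint connected branch sets in `G`,
one for each vertex of `H`, with adjacency in `H` witnessed by edges of `G`. -/
def SimpleGraph.IsMinor {W V : Type} (H : SimpleGraph W) (G : SimpleGraph V) : Prop :=
  ∃ f : W → Set V,
    (∀ w, (G.induce (f w)).Connected) ∧
    (Pairwise fun w₁ w₂ => Disjoint (f w₁) (f w₂)) ∧
    (∀ w₁ w₂, H.Adj w₁ w₂ → ∃ a ∈ f w₁, ∃ b ∈ f w₂, G.Adj a b)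

/-- A simple graph is planar iff it has neither a `K₅` nor a `K₃,₃` minor
(Wagner's theorem). -/
def SimpleGraph.IsPlanar {V : Type} (G : SimpleGraph V) : Prop :=
  ¬ (completeGraph (Fin 5)).IsMinor G ∧
  ¬ (completeBipartiteGraph (Fin 3) (Fin 3)).IsMinor G

/-- `spanningTreeNumbers n` is the set `𝒯(n)` of numbers of spanning trees of
connected simple planar graphs on `n` vertices. -/
def spanningTreeNumbers (n : ℕ) : Set ℕ :=
  {t | ∃ G : SimpleGraph (Fin n), G.Connected ∧ G.IsPlanar ∧ spanningTreeCount G = t}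

/-- The continued fraction `[c₁, …, c_ℓ] = 1/(c₁ + 1/(c₂ + ⋯ + 1/c_ℓ))`. -/
def contFrac : List ℕ → ℚ
  | [] => 0
  | a :: l => 1 / (a + contFrac l)

/-- `altList [b₁, …, b_m] = [b₁, 1, b₂, 1, …, b_m, 1]`. -/
def altList : List ℕ → List ℕ
  | [] => []
  | b :: l => b :: 1 :: altList l

section

open SimpleGraph

theorem SimpleGraph.Reachable.map_of_adj {V W : Type} {G : SimpleGraph V} {H : SimpleGraph W}
    (g : V → W) (hg : ∀ a b, G.Adj a b → H.Reachable (g a) (g b)) {a b : V}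
    (h : G.Reachable a b) : H.Reachable (g a) (g b) := by
  obtain ⟨p⟩ := h
  induction p with
  | nil => rfl
  | cons h _ ih => exact (hg _ _ h).trans ih

theorem SimpleGraph.Connected.map_of_adj {V W : Type} {G : SimpleGraph V} {H : SimpleGraph W}
    (g : V → W) (hg : ∀ a b, G.Adj a b → H.Reachable (g a) (g b))
    (hs : ∀ w, ∃ v, H.Reachable (g v) w) (h : G.Connected) : H.Connected := by
  have : Nonempty W := h.nonempty.map g
  refine ⟨fun a b => ?_⟩
  obtain ⟨a', ha⟩ := hs a
  obtain ⟨b', hb⟩ := hs b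
  exact ha.symm.trans (((h.preconnected a' b').map_of_adj g hg).trans hb)

/-! ### Graphs without minors of minimum degree three -/

/-- No vertex of `H` has its neighbourhood covered by two vertices. -/
def SimpleGraph.DegreeGeThree {W : Type} (H : SimpleGraph W) : Prop :=
  ∀ w a b, ∃ c, H.Adj w c ∧ c ≠ a ∧ c ≠ b

/-- `K` has no minor in which every vertex has degree at least three. -/
def SimpleGraph.NoDenseMinor {V : Type} (K : SimpleGraph V) : Prop :=
  ∀ (W : Type) (H : SimpleGraph W), Nonempty W → H.DegreeGeThree → ¬ H.IsMinor K

theorem SimpleGraph.IsMinor.mono {W V : Type} {H : SimpleGraph W} {G K : SimpleGraph V}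
    (hGK : G ≤ K) (h : H.IsMinor G) : H.IsMinor K := by
  obtain ⟨f, h1, h2, h3⟩ := h
  refine ⟨f, fun w => (h1 w).mono fun a b hab => hGK hab, h2, fun w₁ w₂ h => ?_⟩
  obtain ⟨a, ha, b, hb, hab⟩ := h3 w₁ w₂ h
  exact ⟨a, ha, b, hb, hGK hab⟩

theorem SimpleGraph.NoDenseMinor.isPlanar {V : Type} {G K : SimpleGraph V} (hGK : G ≤ K)
    (hK : K.NoDenseMinor) : G.IsPlanar := by
  refine ⟨fun h => hK _ _ ⟨0⟩ ?_ (h.mono hGK), fun h => hK _ _ ⟨.inl 0⟩ ?_ (h.mono hGK)⟩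
  · intro w a b
    simp only [completeGraph, top_adj]
    revert w a b
    decide
  · have key : ∀ a b : Fin 3 ⊕ Fin 3, (∃ i : Fin 3, .inl i ≠ a ∧ .inl i ≠ b) ∧
        (∃ i : Fin 3, .inr i ≠ a ∧ .inr i ≠ b) := by decide
    intro w a b
    obtain ⟨⟨i, hi⟩, ⟨j, hj⟩⟩ := key a b
    rcases w with w | w
    · exact ⟨.inr j, by simp, hj⟩
    · exact ⟨.inl i, by simp, hi⟩

theorem noDenseMinor_top_fin_two : (⊤ : SimpleGraph (Fin 2)).NoDenseMinor := by
  rintro W H ⟨w⟩ hH ⟨f, h1, h2, -⟩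
  obtain ⟨c, hc, -, -⟩ := hH w w w
  obtain ⟨d, hd, hdc, -⟩ := hH w c c
  have hne : ∀ w, ∃ i, i ∈ f w := fun w => by
    obtain ⟨i⟩ := (h1 w).nonempty
    exact ⟨i, i.2⟩
  choose g hg using hne
  have hinj : ∀ u v, u ≠ v → g u ≠ g v := fun u v huv h =>
    Set.disjoint_left.mp (h2 huv) (hg u) (h ▸ hg v)
  have e1 := hinj _ _ hc.ne
  have e2 := hinj _ _ hd.ne
  have e3 := hinj _ _ hdc
  omega

/-- Adding to `K` a new last vertex joined to `x` and `y`. -/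
def SimpleGraph.addTriangle {n : ℕ} (K : SimpleGraph (Fin n)) (x y : Fin n) :
    SimpleGraph (Fin (n + 1)) :=
  K.map Fin.castSucc ⊔ fromEdgeSet {s(Fin.last n, x.castSucc), s(Fin.last n, y.castSucc)}

section addTriangle

variable {n : ℕ} {K : SimpleGraph (Fin n)} {x y : Fin n}

@[simp] theorem addTriangle_adj_castSucc {a b : Fin n} :
    (K.addTriangle x y).Adj a.castSucc b.castSucc ↔ K.Adj a b := by
  have h1 : ∀ c : Fin n, c.castSucc ≠ Fin.last n := fun c => (Fin.castSucc_lt_last c).ne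
  simpa [addTriangle, SimpleGraph.map_adj', h1] using fun h : K.Adj a b => h.ne

@[simp] theorem addTriangle_adj_last {b : Fin n} :
    (K.addTriangle x y).Adj (Fin.last n) b.castSucc ↔ b = x ∨ b = y := by
  have h1 : ∀ c : Fin n, c.castSucc ≠ Fin.last n := fun c => (Fin.castSucc_lt_last c).ne
  have h2 := fun c => (h1 c).symm
  simp [addTriangle, SimpleGraph.map_adj', h1, h2]

theorem addTriangle_adj_last_right {b : Fin n} :
    (K.addTriangle x y).Adj b.castSucc (Fin.last n) ↔ b = x ∨ b = y := by
  rw [SimpleGraph.adj_comm, addTriangle_adj_last]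

theorem SimpleGraph.NoDenseMinor.addTriangle (hK : K.NoDenseMinor) (hxy : K.Adj x y) :
    (K.addTriangle x y).NoDenseMinor := by
  rintro W H hW hH ⟨f, h1, h2, h3⟩
  have hdisj : ∀ {u v i}, i ∈ f u → i ∈ f v → u = v := fun {u v i} hu hv => by
    by_contra h
    exact Set.disjoint_left.mp (h2 h) hu hv
  have hrep : ∀ w, Fin.last n ∈ f w → ∃ r, (r = x ∨ r = y) ∧ r.castSucc ∈ f w := by
    intro w hw
    by_contra! hcon
    have hlast : ∀ i ∈ f w, i = Fin.last n := by
      intro i hi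
      have hr := (h1 w).preconnected ⟨_, hw⟩ ⟨i, hi⟩
      obtain ⟨p⟩ := hr
      cases p with
      | nil => rfl
      | @cons _ v _ h _ =>
        obtain ⟨v, hv⟩ := v
        induction v using Fin.lastCases with
        | last => simp at h
        | cast v =>
          simp only [comap_adj, Function.Embedding.subtype_apply, addTriangle_adj_last] at h
          exact absurd hv (hcon v h)
    have hown : ∀ r : Fin n, ∃ u, ∀ v, r.castSucc ∈ f v → v = u := fun r => by
      by_cases h : ∃ u, r.castSucc ∈ f u
      · obtain ⟨u, hu⟩ := h
        exact ⟨u, fun v hv => hdisj hv hu⟩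
      · exact ⟨w, fun v hv => absurd ⟨v, hv⟩ h⟩
    obtain ⟨a, ha⟩ := hown x
    obtain ⟨b, hb⟩ := hown y
    obtain ⟨c, hwc, hca, hcb⟩ := hH w a b
    obtain ⟨i, hi, j, hj, hij⟩ := h3 _ _ hwc
    rw [hlast i hi] at hij
    induction j using Fin.lastCases with
    | last => simp at hij
    | cast j =>
      rcases addTriangle_adj_last.mp hij with rfl | rfl
      · exact hca (ha _ hj)
      · exact hcb (hb _ hj)
  refine hK W H hW hH ⟨fun w => Fin.castSucc ⁻¹' f w, fun w => ?_, fun u v huv => ?_, ?_⟩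
  · obtain ⟨r, hr⟩ : ∃ r, Fin.last n ∈ f w → (r = x ∨ r = y) ∧ r.castSucc ∈ f w := by
      by_cases hw : Fin.last n ∈ f w
      · obtain ⟨r, hr⟩ := hrep w hw
        exact ⟨r, fun _ => hr⟩
      · exact ⟨x, fun h => absurd h hw⟩
    let g : Fin (n + 1) → Fin n := Fin.lastCases r id
    have hg : ∀ i ∈ f w, (g i).castSucc ∈ f w := fun i hi => by
      induction i using Fin.lastCases with
      | last => simpa [g] using (hr hi).2
      | cast i => simpa [g] using hi
    have hadj : ∀ b : Fin n, Fin.last n ∈ f w → (b = x ∨ b = y) → r = b ∨ K.Adj r b := by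
      intro b hw hb
      rcases (hr hw).1 with h | h <;> rcases hb with h' | h' <;> subst h <;> subst h' <;>
        simp [hxy, hxy.symm]
    refine (h1 w).map_of_adj (fun i : f w => (⟨g i, hg _ i.2⟩ : Fin.castSucc ⁻¹' f w)) ?_ ?_
    · rintro ⟨i, hi⟩ ⟨j, hj⟩ hij
      have key : g i = g j ∨ K.Adj (g i) (g j) := by
        simp only [comap_adj, Function.Embedding.subtype_apply] at hij
        induction i using Fin.lastCases with
        | last =>
          induction j using Fin.lastCases with
          | last => simp at hij
          | cast j => simpa [g] using hadj j hi (addTriangle_adj_last.mp hij)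
        | cast i =>
          induction j using Fin.lastCases with
          | last =>
            simpa [g, eq_comm, SimpleGraph.adj_comm] using
              hadj i hj (addTriangle_adj_last_right.mp hij)
          | cast j => simpa [g] using Or.inr hij
      rcases key with h | h
      · simp only [h]
        rfl
      · exact Adj.reachable (by simpa using h)
    · rintro ⟨i, hi⟩
      exact ⟨⟨i.castSucc, hi⟩, by simp [g]⟩
  · exact (h2 huv).preimage _
  · have swap : ∀ w₁ w₂, H.Adj w₁ w₂ → ∀ j : Fin n, Fin.last n ∈ f w₁ → j.castSucc ∈ f w₂ →
        (j = x ∨ j = y) → ∃ r, r.castSucc ∈ f w₁ ∧ K.Adj r j := by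
      intro w₁ w₂ hw j hl hj hxy'
      obtain ⟨r, hr, hrf⟩ := hrep w₁ hl
      have hne : r ≠ j := by
        rintro rfl
        exact hw.ne (hdisj hrf hj)
      refine ⟨r, hrf, ?_⟩
      rcases hr with h | h <;> rcases hxy' with h' | h' <;> subst h <;> subst h' <;>
        first | exact absurd rfl hne | exact hxy | exact hxy.symm
    intro w₁ w₂ hw
    obtain ⟨i, hi, j, hj, hij⟩ := h3 _ _ hw
    induction i using Fin.lastCases with
    | last =>
      induction j using Fin.lastCases with
      | last => simp at hij
      | cast j =>
        obtain ⟨r, hr, hrj⟩ := swap w₁ w₂ hw j hi hj (addTriangle_adj_last.mp hij)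
        exact ⟨r, hr, j, hj, hrj⟩
    | cast i =>
      induction j using Fin.lastCases with
      | last =>
        obtain ⟨r, hr, hrj⟩ := swap w₂ w₁ hw.symm i hj hi (addTriangle_adj_last_right.mp hij)
        exact ⟨i, hi, r, hr, hrj.symm⟩
      | cast j => exact ⟨i, hi, j, hj, by simpa using hij⟩

end addTriangle

/-! ### Connectedness after adding a vertex -/

/-- The set of edges of `Fin (n + 1)` coming from a set of edges of `Fin n`. -/
def liftEdges {n : ℕ} (T : Set (Sym2 (Fin n))) : Set (Sym2 (Fin (n + 1))) :=
  Sym2.map Fin.castSucc '' T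

section liftEdges

variable {n : ℕ} {T : Set (Sym2 (Fin n))} {x y : Fin n}

@[simp] theorem castSucc_mem_liftEdges {a b : Fin n} :
    s(a.castSucc, b.castSucc) ∈ liftEdges T ↔ s(a, b) ∈ T := by
  rw [liftEdges, ← Sym2.map_mk]
  exact (Sym2.map.injective (Fin.castSucc_injective n)).mem_set_image

@[simp] theorem last_notMem_liftEdges {a : Fin (n + 1)} : s(Fin.last n, a) ∉ liftEdges T := by
  rintro ⟨e, -, he⟩
  have : Fin.last n ∈ Sym2.map Fin.castSucc e := by simp [he]
  obtain ⟨c, -, hc⟩ := Sym2.mem_map.mp this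
  exact (Fin.castSucc_lt_last c).ne hc

@[simp] theorem last_notMem_liftEdges' {a : Fin (n + 1)} : s(a, Fin.last n) ∉ liftEdges T := by
  rw [Sym2.eq_swap]
  exact last_notMem_liftEdges

theorem connected_subdivide (hxy : x ≠ y) :
    (fromEdgeSet (insert s(Fin.last n, y.castSucc)
      (insert s(Fin.last n, x.castSucc) (liftEdges T)))).Connected ↔
      (fromEdgeSet (insert s(x, y) T)).Connected := by
  have h1 : ∀ c : Fin n, c.castSucc ≠ Fin.last n := fun c => (Fin.castSucc_lt_last c).ne
  have h2 := fun c => (h1 c).symm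
  constructor
  · refine Connected.map_of_adj (Fin.lastCases x id : Fin (n + 1) → Fin n) ?_
      fun w => ⟨w.castSucc, by simp⟩
    intro a b hab
    have hr : (fromEdgeSet (insert s(x, y) T)).Reachable x y := Adj.reachable (by simp [hxy])
    induction a using Fin.lastCases with
    | last =>
      induction b using Fin.lastCases with
      | last => simp at hab
      | cast b =>
        simp [h1, h2] at hab
        rcases hab with rfl | rfl <;> simp [hr]
    | cast a =>
      induction b using Fin.lastCases with
      | last =>
        simp [h1, h2] at hab
        rcases hab with rfl | rfl <;> simp [hr.symm]
      | cast b =>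
        simp [h1] at hab
        exact Adj.reachable (by simp [hab])
  · set G := fromEdgeSet (insert s(Fin.last n, y.castSucc)
      (insert s(Fin.last n, x.castSucc) (liftEdges T))) with hG
    have hx : G.Reachable x.castSucc (Fin.last n) := Adj.reachable (by simp [hG, h1, h2])
    have hy : G.Reachable y.castSucc (Fin.last n) := Adj.reachable (by simp [hG, h1, h2])
    refine Connected.map_of_adj Fin.castSucc ?_ fun w => ?_
    · intro a b hab
      simp only [fromEdgeSet_adj, Set.mem_insert_iff, Sym2.eq_iff] at hab
      obtain ⟨(⟨rfl, rfl⟩ | ⟨rfl, rfl⟩) | h, hne⟩ := hab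
      · exact hx.trans hy.symm
      · exact hy.trans hx.symm
      · exact Adj.reachable (by simp [hG, h, hne])
    · induction w using Fin.lastCases with
      | last => exact ⟨x, hx⟩
      | cast w => exact ⟨w, by rfl⟩

theorem connected_pendant :
    (fromEdgeSet (insert s(Fin.last n, x.castSucc) (liftEdges T))).Connected ↔
      (fromEdgeSet T).Connected := by
  have h1 : ∀ c : Fin n, c.castSucc ≠ Fin.last n := fun c => (Fin.castSucc_lt_last c).ne
  have h2 := fun c => (h1 c).symm
  constructor
  · refine Connected.map_of_adj (Fin.lastCases x id : Fin (n + 1) → Fin n) ?_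
      fun w => ⟨w.castSucc, by simp⟩
    intro a b hab
    induction a using Fin.lastCases with
    | last =>
      induction b using Fin.lastCases with
      | last => simp at hab
      | cast b =>
        simp [h1, h2] at hab
        simp [hab]
    | cast a =>
      induction b using Fin.lastCases with
      | last =>
        simp [h1, h2] at hab
        simp [hab]
      | cast b =>
        simp [h1] at hab
        exact Adj.reachable (by simp [hab])
  · refine Connected.map_of_adj Fin.castSucc ?_ fun w => ?_
    · intro a b hab
      simp only [fromEdgeSet_adj] at hab
      exact Adj.reachable (by simp [hab])
    · induction w using Fin.lastCases with
      | last => exact ⟨x, Adj.reachable (by simp [h1, h2])⟩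
      | cast w => exact ⟨w, by rfl⟩

theorem not_connected_liftEdges (x : Fin n) : ¬ (fromEdgeSet (liftEdges T)).Connected := by
  intro h
  obtain ⟨p⟩ := h.preconnected (Fin.last n) x.castSucc
  generalize hi : x.castSucc = i at p
  cases p with
  | nil => exact (Fin.castSucc_lt_last x).ne hi
  | cons h _ => simp at h

theorem ncard_liftEdges : (liftEdges T).ncard = T.ncard :=
  Set.ncard_image_of_injective _ (Sym2.map.injective (Fin.castSucc_injective n))

theorem ncard_insert_liftEdges :
    (insert s(Fin.last n, x.castSucc) (liftEdges T)).ncard = T.ncard + 1 := by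
  rw [Set.ncard_insert_of_notMem last_notMem_liftEdges, ncard_liftEdges]

end liftEdges

/-! ### Counting spanning trees and separating forests -/

theorem ncard_subsets_insert {α : Type} [Finite α] {E : Set α} {e : α} (he : e ∉ E)
    (P : Set α → Prop) :
    {T | T ⊆ insert e E ∧ P T}.ncard =
      {T | T ⊆ E ∧ P T}.ncard + {T | T ⊆ E ∧ P (insert e T)}.ncard := by
  have hsplit : {T | T ⊆ insert e E ∧ P T} =
      {T | T ⊆ E ∧ P T} ∪ insert e '' {T | T ⊆ E ∧ P (insert e T)} := by
    ext T
    simp only [Set.mem_ofPred_eq, Set.mem_union, Set.mem_image]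
    constructor
    · rintro ⟨hT, hP⟩
      by_cases h : e ∈ T
      · refine Or.inr ⟨T \ {e}, ⟨?_, ?_⟩, ?_⟩
        · simpa [Set.sdiff_subset_iff] using hT
        · simpa [Set.insert_eq_of_mem h] using hP
        · simp [Set.insert_eq_of_mem h]
      · exact Or.inl ⟨(Set.subset_insert_iff_of_notMem h).mp hT, hP⟩
    · rintro (⟨hT, hP⟩ | ⟨T, ⟨hT, hP⟩, rfl⟩)
      · exact ⟨hT.trans (Set.subset_insert _ _), hP⟩
      · exact ⟨Set.insert_subset_insert hT, hP⟩
  rw [hsplit, Set.ncard_union_eq, Set.InjOn.ncard_image]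
  · rintro S ⟨hS, -⟩ T ⟨hT, -⟩ h
    have h' := congrArg (· \ {e}) h
    simpa [Set.insert_sdiff_self_of_notMem (fun h => he (hS h)),
      Set.insert_sdiff_self_of_notMem (fun h => he (hT h))] using h'
  · rw [Set.disjoint_left]
    rintro _ ⟨hT, -⟩ ⟨S, -, rfl⟩
    exact he (hT (Set.mem_insert _ _))

theorem ncard_subsets_liftEdges {n : ℕ} (E : Set (Sym2 (Fin n)))
    (P : Set (Sym2 (Fin (n + 1))) → Prop) :
    {T | T ⊆ liftEdges E ∧ P T}.ncard = {T | T ⊆ E ∧ P (liftEdges T)}.ncard := by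
  have himg : {T | T ⊆ liftEdges E ∧ P T} = liftEdges '' {T | T ⊆ E ∧ P (liftEdges T)} := by
    ext T
    simp only [Set.mem_ofPred_eq, Set.mem_image]
    constructor
    · rintro ⟨hT, hP⟩
      obtain ⟨S, hS, rfl⟩ := Set.subset_image_iff.mp hT
      exact ⟨S, ⟨hS, hP⟩, rfl⟩
    · rintro ⟨S, ⟨hS, hP⟩, rfl⟩
      exact ⟨Set.image_mono hS, hP⟩
  rw [himg]
  exact Set.ncard_image_of_injective _
    (Sym2.map.injective (Fin.castSucc_injective n)).image_injective

/-- The number of spanning trees of the graph on `Fin n` with edge set `E`. -/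
noncomputable def treeCount {n : ℕ} (E : Set (Sym2 (Fin n))) : ℕ :=
  {T | T ⊆ E ∧ (fromEdgeSet T).Connected ∧ T.ncard + 1 = n}.ncard

/-- The number of two-component spanning forests of the graph on `Fin n` with edge set `E`
that separate `x` from `y`. -/
noncomputable def forestCount {n : ℕ} (E : Set (Sym2 (Fin n))) (x y : Fin n) : ℕ :=
  {T | T ⊆ E ∧ (fromEdgeSet (insert s(x, y) T)).Connected ∧ T.ncard + 2 = n}.ncard

theorem spanningTreeCount_eq_treeCount {n : ℕ} (G : SimpleGraph (Fin n)) :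
    spanningTreeCount G = treeCount G.edgeSet := by
  rw [spanningTreeCount, treeCount]
  change Set.ncard {T | T ⊆ G.edgeSet ∧ (fromEdgeSet T).IsTree} = _
  congr 1
  ext T
  simp only [Set.mem_ofPred_eq]
  refine and_congr_right fun hT => ?_
  have hE : (fromEdgeSet T).edgeSet = T := by
    rw [edgeSet_fromEdgeSet, sdiff_eq_left, Set.disjoint_left]
    exact fun e he => G.not_isDiag_of_mem_edgeSet (hT he)
  rw [isTree_iff_connected_and_card, hE, Nat.card_fin, Nat.card_coe_set_eq]

section counts

variable {n : ℕ} {E : Set (Sym2 (Fin n))} {x y : Fin n}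

theorem treeCount_insert (hE : s(x, y) ∉ E) :
    treeCount (insert s(x, y) E) = treeCount E + forestCount E x y := by
  rw [treeCount, ncard_subsets_insert hE, treeCount, forestCount]
  congr 2
  ext T
  simp only [Set.mem_ofPred_eq]
  refine and_congr_right fun hT => ?_
  rw [Set.ncard_insert_of_notMem fun h => hE (hT h)]

theorem forestCount_insert (hE : s(x, y) ∉ E) :
    forestCount (insert s(x, y) E) x y = forestCount E x y := by
  rw [forestCount, ncard_subsets_insert hE, forestCount, Nat.add_eq_left, Set.ncard_eq_zero,
    Set.eq_empty_iff_forall_notMem]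
  rintro T ⟨-, hc, hcard⟩
  rw [Set.insert_idem] at hc
  have h := hc.card_vert_le_card_edgeSet_add_one
  rw [Nat.card_fin, Nat.card_coe_set_eq] at h
  have h' : (fromEdgeSet (insert s(x, y) T)).edgeSet.ncard ≤ (insert s(x, y) T).ncard :=
    Set.ncard_le_ncard (by simp only [edgeSet_fromEdgeSet]; exact Set.sdiff_subset)
  omega

theorem treeCount_pendant :
    treeCount (insert s(Fin.last n, x.castSucc) (liftEdges E)) = treeCount E := by
  rw [treeCount, ncard_subsets_insert last_notMem_liftEdges, ncard_subsets_liftEdges,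
    ncard_subsets_liftEdges]
  have hcard := fun T : Set (Sym2 (Fin n)) => ncard_insert_liftEdges (T := T) (x := x)
  simp [not_connected_liftEdges x, connected_pendant, hcard, treeCount]

theorem forestCount_pendant (hxy : x ≠ y) :
    forestCount (insert s(Fin.last n, x.castSucc) (liftEdges E)) (Fin.last n) y.castSucc =
      treeCount E + forestCount E x y := by
  rw [forestCount, ncard_subsets_insert last_notMem_liftEdges, ncard_subsets_liftEdges,
    ncard_subsets_liftEdges]
  have hcard := fun T : Set (Sym2 (Fin n)) => ncard_insert_liftEdges (T := T) (x := x)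
  simp [connected_subdivide hxy, connected_pendant, ncard_liftEdges, hcard, treeCount, forestCount]

end counts

/-! ### The construction -/

/-- `E` is the edge set of a graph with `p` spanning trees and `q` two-component spanning forests
separating `x` from `y`, which embeds in a graph without dense minors in which `x` and `y` are
adjacent. -/
structure IsTerminalGraph {n : ℕ} (E : Set (Sym2 (Fin n))) (x y : Fin n) (p q : ℕ) : Prop where
  exists_noDenseMinor : ∃ K : SimpleGraph (Fin n), K.NoDenseMinor ∧ K.Adj x y ∧ E ⊆ K.edgeSet
  treeCount_eq : treeCount E = p
  forestCount_eq : forestCount E x y = q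

namespace IsTerminalGraph

variable {n p q : ℕ} {E : Set (Sym2 (Fin n))} {x y : Fin n}

theorem addEdge (h : IsTerminalGraph E x y p q) (hE : s(x, y) ∉ E) :
    IsTerminalGraph (insert s(x, y) E) x y (p + q) q := by
  obtain ⟨⟨K, hK, hxy, hEK⟩, rfl, rfl⟩ := h
  exact ⟨⟨K, hK, hxy, Set.insert_subset hxy hEK⟩, treeCount_insert hE, forestCount_insert hE⟩

theorem addPendant (h : IsTerminalGraph E x y p q) :
    IsTerminalGraph (insert s(Fin.last n, x.castSucc) (liftEdges E)) (Fin.last n) y.castSucc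
      p (p + q) := by
  obtain ⟨⟨K, hK, hxy, hEK⟩, rfl, rfl⟩ := h
  refine ⟨⟨K.addTriangle x y, hK.addTriangle hxy, by simp, ?_⟩, treeCount_pendant,
    forestCount_pendant hxy.ne⟩
  refine Set.insert_subset (by simp) ?_
  rintro _ ⟨e, he, rfl⟩
  induction e with
  | _ a b => simpa using hEK he

end IsTerminalGraph

/-- There is a terminal graph on `n` vertices with counts `p` and `q` and nonadjacent
terminals. -/
def Realizable (n p q : ℕ) : Prop :=
  ∃ (E : Set (Sym2 (Fin n))) (x y : Fin n), s(x, y) ∉ E ∧ IsTerminalGraph E x y p q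

theorem realizable_two : Realizable 2 0 1 := by
  refine ⟨∅, 0, 1, by simp, ⟨⊤, noDenseMinor_top_fin_two, by simp, by simp⟩, ?_, ?_⟩
  · have : ∀ T : Set (Sym2 (Fin 2)), ¬ (T ⊆ ∅ ∧ (fromEdgeSet T).Connected ∧ T.ncard + 1 = 2) := by
      rintro T ⟨hT, -, h⟩
      simp [Set.subset_empty_iff.mp hT] at h
    simp only [treeCount, this, Set.ofPred_false, Set.ncard_empty]
  · have hc : (fromEdgeSet {s((0 : Fin 2), 1)}).Connected := by
      have h : (fromEdgeSet {s((0 : Fin 2), 1)}).Reachable 0 1 := Adj.reachable (by simp)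
      refine ⟨fun a b => ?_⟩
      fin_cases a <;> fin_cases b
      · rfl
      · exact h
      · exact h.symm
      · rfl
    have : {T : Set (Sym2 (Fin 2)) | T ⊆ ∅ ∧ (fromEdgeSet (insert s(0, 1) T)).Connected ∧
        T.ncard + 2 = 2} = {∅} := by
      ext T
      simp only [Set.subset_empty_iff, Set.mem_ofPred_eq, Set.mem_singleton_iff]
      refine ⟨And.left, ?_⟩
      rintro rfl
      simp [hc]
    rw [forestCount, this, Set.ncard_singleton]

theorem Realizable.addEar {n p q : ℕ} (h : Realizable n p q) (b : ℕ) :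
    Realizable (n + (b + 1)) (p + q) ((b + 1) * (p + q) + q) := by
  induction b with
  | zero =>
    obtain ⟨E, x, y, hE, h⟩ := h
    refine ⟨_, _, _, ?_, by simpa using (h.addEdge hE).addPendant⟩
    simp [Fin.castSucc_inj, (h.exists_noDenseMinor.choose_spec.2.1).ne']
  | succ b ih =>
    obtain ⟨E, x, y, -, h⟩ := ih
    refine ⟨_, _, _, ?_, (?_ : (p + q) + ((b + 1) * (p + q) + q) = _) ▸ h.addPendant⟩
    · simp [Fin.castSucc_inj, (h.exists_noDenseMinor.choose_spec.2.1).ne']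
    · ring

theorem Realizable.exists_graph {n p q : ℕ} (h : Realizable n p q) (hpos : 0 < p + q) :
    ∃ G : SimpleGraph (Fin n), G.Connected ∧ G.IsPlanar ∧ spanningTreeCount G = p + q := by
  obtain ⟨E, x, y, hE, h⟩ := h
  obtain ⟨⟨K, hK, -, hEK⟩, hp, -⟩ := h.addEdge hE
  set F := insert s(x, y) E
  have hF : (fromEdgeSet F).edgeSet = F := by
    rw [edgeSet_fromEdgeSet, sdiff_eq_left, Set.disjoint_left]
    exact fun e he => K.not_isDiag_of_mem_edgeSet (hEK he)
  refine ⟨fromEdgeSet F, ?_, hK.isPlanar ?_, by rw [spanningTreeCount_eq_treeCount, hF, hp]⟩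
  · rw [← hp, treeCount, Set.ncard_pos] at hpos
    obtain ⟨T, hT, hc, -⟩ := hpos
    exact hc.mono (fromEdgeSet_mono hT)
  · rwa [← edgeSet_subset_edgeSet, hF]

theorem contFrac_altList_cons {b p q : ℕ} {l : List ℕ} (hq : 0 < q)
    (h : contFrac (altList l) = (p : ℚ) / q) :
    contFrac (altList (b :: l)) = ((p + q : ℕ) : ℚ) / ((b * (p + q) + q : ℕ) : ℚ) := by
  have hq' : (0 : ℚ) < q := by exact_mod_cast hq
  simp only [altList, contFrac, h]
  push_cast
  field_simp
  ring

theorem coprime_step {b p q : ℕ} (h : Nat.Coprime p q) :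
    Nat.Coprime (p + q) (b * (p + q) + q) := by
  simpa using h

theorem exists_realizable (l : List ℕ) (hl : ∀ b ∈ l, 0 < b) :
    ∃ p q : ℕ, 0 < q ∧ Nat.Coprime p q ∧ contFrac (altList l) = (p : ℚ) / q ∧
      Realizable (l.sum + 2) p q := by
  induction l with
  | nil => exact ⟨0, 1, by simp, by simp, by simp [altList, contFrac], realizable_two⟩
  | cons b l ih =>
    obtain ⟨p, q, hq, hcop, hcf, hr⟩ := ih fun c hc => hl c (List.mem_cons_of_mem _ hc)
    obtain ⟨b, rfl⟩ := Nat.exists_eq_succ_of_ne_zero (hl b List.mem_cons_self).ne'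
    refine ⟨_, _, by positivity, coprime_step hcop, contFrac_altList_cons hq hcf, ?_⟩
    have hsum : ((b + 1) :: l).sum + 2 = l.sum + 2 + (b + 1) := by
      rw [List.sum_cons]
      ring
    rw [Nat.succ_eq_add_one, hsum]
    exact hr.addEar b

end

/-- Main Graph Theorem: if coprime `t < u` satisfy `t/u = [b₁,1,b₂,1,…,b_m,1]`
with all `bᵢ ≥ 1`, then there is a connected simple planar graph on
`b₂ + ⋯ + b_m + 2` vertices with exactly `t` spanning trees. -/
theorem main_graph_theorem (t u : ℕ) (ht : 0 < t) (htu : t < u) (hcop : Nat.Coprime t u)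
    (B : List ℕ) (hB : B ≠ []) (hpos : ∀ b ∈ B, 0 < b)
    (hcf : (t : ℚ) / (u : ℚ) = contFrac (altList B)) :
    ∃ G : SimpleGraph (Fin (B.tail.sum + 2)),
      G.Connected ∧ G.IsPlanar ∧ spanningTreeCount G = t := by
  obtain ⟨b, l, rfl⟩ := List.exists_cons_of_ne_nil hB
  obtain ⟨p, q, hq, hpq, hl, hr⟩ := exists_realizable l fun c hc =>
    hpos c (List.mem_cons_of_mem _ hc)
  rw [contFrac_altList_cons hq hl] at hcf
  obtain rfl : t = p + q := by
    have hcop' := coprime_step (b := b) hpq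
    have hu : 0 < b * (p + q) + q := by positivity
    have h := (Rat.div_int_inj (a := t) (b := u) (c := (p + q : ℕ)) (d := (b * (p + q) + q : ℕ))
      (by omega) (by omega) hcop hcop' (by simpa only [Int.cast_natCast] using hcf)).1
    exact Int.natCast_inj.mp h
  exact hr.exists_graph ht
end

section
/- Let t, u be coprime positive integers with t ≤ u such that t/u = [b_1, 1, b_2, 1, …, b_m, 1] for positive integers b_1, …, b_m. Then there exists a simple planar connected graph G = (V, E) and an edge e ∈ E with τ(G − e) = t, τ(G/e) = u, and |V| = b_1 + ⋯ + b_m + 2. -/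
/-- A finite multigraph without loops: edges are oriented pairs of distinct vertices;
parallel edges are allowed since `E` is an arbitrary type. -/
structure Multigraph (V E : Type) where
  fst : E → V
  snd : E → V
  no_loop : ∀ e, fst e ≠ snd e

namespace Multigraph

variable {V E : Type}

/-- The simple graph on `V` whose edges are the (unordered) endpoint pairs of the
edges in the set `T`. -/
def simpleOf (M : Multigraph V E) (T : Set E) : SimpleGraph V :=
  SimpleGraph.fromEdgeSet {s | ∃ e ∈ T, s = s(M.fst e, M.snd e)}

/-- `T` is a spanning tree of the multigraph `M`: it connects all the vertices and
has exactly `|V| - 1` edges. -/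
def IsSpanningTree (M : Multigraph V E) (T : Set E) : Prop :=
  (M.simpleOf T).Connected ∧ T.ncard = Nat.card V - 1

/-- The number of spanning trees of the multigraph `M`. -/
noncomputable def tau (M : Multigraph V E) : ℕ :=
  Nat.card {T : Set E // M.IsSpanningTree T}

/-- Deletion of the edge `e`. -/
def delete (M : Multigraph V E) (e : E) : Multigraph V {e' : E // e' ≠ e} where
  fst e' := M.fst e'.1
  snd e' := M.snd e'.1
  no_loop e' := M.no_loop e'.1

open Classical in
/-- The map sending `snd e` to `fst e` and fixing all other vertices. -/
noncomputable def contractMap (M : Multigraph V E) (e : E) (v : V) :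
    {w : V // w ≠ M.snd e} :=
  if h : v = M.snd e then ⟨M.fst e, M.no_loop e⟩ else ⟨v, h⟩

/-- Contraction of the edge `e`: the endpoints of `e` are identified, and the
resulting loops (including `e` itself) are removed. -/
noncomputable def contract (M : Multigraph V E) (e : E) :
    Multigraph {w : V // w ≠ M.snd e}
      {e' : E // e' ≠ e ∧ M.contractMap e (M.fst e') ≠ M.contractMap e (M.snd e')} where
  fst e' := M.contractMap e (M.fst e'.1)
  snd e' := M.contractMap e (M.snd e'.1)
  no_loop e' := e'.2.2

/-- The multigraph is simple: distinct edges have distinct endpoint pairs. -/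
def Simple (M : Multigraph V E) : Prop :=
  ∀ e₁ e₂ : E, s(M.fst e₁, M.snd e₁) = s(M.fst e₂, M.snd e₂) → e₁ = e₂

end Multigraph

/-- Edges of a fan are coded by natural numbers: `2 * k` is the spoke from the hub to the `k`-th
rim vertex, `2 * i + 1` is the rim edge from `i` to `i + 1`. The rim vertex `j` is joined to the
hub by the edges in `T` if some spoke in `T` can be reached along rim edges in `T`. -/
def FanLinked (N : ℕ) (T : Finset ℕ) (j : ℕ) : Prop :=
  ∃ k ≤ N, 2 * k ∈ T ∧ ∀ i, (j ≤ i ∧ i < k ∨ k ≤ i ∧ i < j) → 2 * i + 1 ∈ T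

/-- The edge set `T` connects the hub and the rim vertices `0, …, N`. -/
def FanConnected (N : ℕ) (T : Finset ℕ) : Prop :=
  ∀ j ≤ N, FanLinked N T j

/-- The edge set `T` is a spanning tree of the fan with rim `0, …, N`. -/
def FanTree (N : ℕ) (T : Finset ℕ) : Prop :=
  FanConnected N T ∧ T.card = N + 1

section FanConnected

variable {N : ℕ} {T : Finset ℕ}

theorem not_fanConnected_succ (hT : ∀ x ∈ T, x ≤ 2 * N) : ¬ FanConnected (N + 1) T := by
  intro h
  obtain ⟨k, hk, hkT, hp⟩ := h (N + 1) le_rfl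
  have h1 := hT _ hkT
  have h2 := hT _ (hp N (by omega))
  omega

theorem fanConnected_succ_insert_rim (hT : ∀ x ∈ T, x ≤ 2 * N) :
    FanConnected (N + 1) (insert (2 * N + 1) T) ↔ FanConnected N T := by
  constructor
  · intro h j hj
    obtain ⟨k, hk, hkT, hp⟩ := h j (by omega)
    have hkT' : 2 * k ∈ T := Finset.mem_of_mem_insert_of_ne hkT (by omega)
    have h1 := hT _ hkT'
    exact ⟨k, by omega, hkT', fun i hi =>
      Finset.mem_of_mem_insert_of_ne (hp i hi) (by omega)⟩
  · intro h j hj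
    obtain ⟨k, hk, hkT, hp⟩ := h (min j N) (by omega)
    refine ⟨k, by omega, Finset.mem_insert_of_mem hkT, fun i hi => ?_⟩
    by_cases hiN : i = N
    · simp [hiN]
    · exact Finset.mem_insert_of_mem (hp i (by omega))

theorem fanConnected_succ_insert_spoke (hT : ∀ x ∈ T, x ≤ 2 * N) :
    FanConnected (N + 1) (insert (2 * (N + 1)) T) ↔ FanConnected N T := by
  constructor
  · intro h j hj
    obtain ⟨k, hk, hkT, hp⟩ := h j (by omega)
    have hp' : ∀ i, (j ≤ i ∧ i < k ∨ k ≤ i ∧ i < j) → 2 * i + 1 ∈ T := fun i hi =>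
      Finset.mem_of_mem_insert_of_ne (hp i hi) (by omega)
    have hkN : k ≤ N := by
      by_contra hcon
      have := hT _ (hp' N (by omega))
      omega
    exact ⟨k, hkN, Finset.mem_of_mem_insert_of_ne hkT (by omega), hp'⟩
  · intro h j hj
    by_cases hjN : j = N + 1
    · exact ⟨N + 1, le_rfl, by simp, fun i hi => by omega⟩
    · obtain ⟨k, hk, hkT, hp⟩ := h j (by omega)
      exact ⟨k, by omega, Finset.mem_insert_of_mem hkT, fun i hi =>
        Finset.mem_insert_of_mem (hp i hi)⟩

theorem fanConnected_succ_insert_spoke_rim :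
    FanConnected (N + 1) (insert (2 * (N + 1)) (insert (2 * N + 1) T)) ↔
      FanConnected N (insert (2 * N) T) := by
  constructor
  · intro h j hj
    obtain ⟨k, hk, hkT, hp⟩ := h j (by omega)
    have hp' : ∀ i < N, (j ≤ i ∧ i < k ∨ k ≤ i ∧ i < j) → 2 * i + 1 ∈ insert (2 * N) T := by
      intro i hiN hi
      have := hp i hi
      simp only [Finset.mem_insert] at this ⊢
      grind
    by_cases hkN : k ≤ N
    · refine ⟨k, hkN, ?_, fun i hi => hp' i (by omega) hi⟩
      simp only [Finset.mem_insert] at hkT ⊢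
      grind
    · exact ⟨N, le_rfl, by simp, fun i hi => hp' i (by omega) (by omega)⟩
  · intro h j hj
    by_cases hjN : j = N + 1
    · exact ⟨N + 1, le_rfl, by simp, fun i hi => by omega⟩
    · obtain ⟨k, hk, hkT, hp⟩ := h j (by omega)
      have hp' : ∀ i, (j ≤ i ∧ i < k ∨ k ≤ i ∧ i < j) →
          2 * i + 1 ∈ insert (2 * (N + 1)) (insert (2 * N + 1) T) := fun i hi =>
        Finset.mem_insert_of_mem (Finset.mem_insert_of_mem
          (Finset.mem_of_mem_insert_of_ne (hp i hi) (by omega)))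
      by_cases hkN : k = N
      · refine ⟨N + 1, le_rfl, by simp, fun i hi => ?_⟩
        by_cases hiN : i = N
        · simp [hiN]
        · exact hp' i (by omega)
      · refine ⟨k, by omega, ?_, hp'⟩
        simp only [Finset.mem_insert] at hkT ⊢
        grind

theorem FanConnected.succ_le_card (hT : ∀ x ∈ T, x ≤ 2 * N) (h : FanConnected N T) :
    N + 1 ≤ T.card := by
  induction N generalizing T with
  | zero =>
    obtain ⟨k, -, hkT, -⟩ := h 0 le_rfl
    exact Finset.card_pos.2 ⟨_, hkT⟩
  | succ N ih =>
    set T₀ := T.filter (· ≤ 2 * N) with hT₀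
    have hb : ∀ x ∈ T₀, x ≤ 2 * N := fun x hx => (Finset.mem_filter.1 hx).2
    have h1 : 2 * N + 1 ∉ T₀ := fun hx => by have := hb _ hx; omega
    have h2 : 2 * (N + 1) ∉ T₀ := fun hx => by have := hb _ hx; omega
    by_cases hr : 2 * N + 1 ∈ T <;> by_cases hs : 2 * (N + 1) ∈ T
    · have hTe : T = insert (2 * (N + 1)) (insert (2 * N + 1) T₀) := by grind
      rw [hTe, fanConnected_succ_insert_spoke_rim] at h
      have h3 := ih (by grind) h
      have h4 := Finset.card_insert_le (2 * N) T₀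
      rw [hTe, Finset.card_insert_of_notMem (by grind), Finset.card_insert_of_notMem h1]
      omega
    · have hTe : T = insert (2 * N + 1) T₀ := by grind
      rw [hTe, fanConnected_succ_insert_rim hb] at h
      have h3 := ih hb h
      rw [hTe, Finset.card_insert_of_notMem h1]
      omega
    · have hTe : T = insert (2 * (N + 1)) T₀ := by grind
      rw [hTe, fanConnected_succ_insert_spoke hb] at h
      have h3 := ih hb h
      rw [hTe, Finset.card_insert_of_notMem h2]
      omega
    · have hTe : T = T₀ := by grind
      rw [hTe] at h
      exact absurd h (not_fanConnected_succ hb)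

theorem not_fanTree_succ (hT : ∀ x ∈ T, x ≤ 2 * N) : ¬ FanTree (N + 1) T :=
  fun h => not_fanConnected_succ hT h.1

theorem fanTree_succ_insert_rim (hT : ∀ x ∈ T, x ≤ 2 * N) :
    FanTree (N + 1) (insert (2 * N + 1) T) ↔ FanTree N T := by
  rw [FanTree, FanTree, fanConnected_succ_insert_rim hT,
    Finset.card_insert_of_notMem fun hx => by have := hT _ hx; omega, Nat.add_right_cancel_iff]

theorem fanTree_succ_insert_spoke (hT : ∀ x ∈ T, x ≤ 2 * N) :
    FanTree (N + 1) (insert (2 * (N + 1)) T) ↔ FanTree N T := by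
  rw [FanTree, FanTree, fanConnected_succ_insert_spoke hT,
    Finset.card_insert_of_notMem fun hx => by have := hT _ hx; omega, Nat.add_right_cancel_iff]

theorem fanTree_succ_insert_spoke_rim (hT : ∀ x ∈ T, x ≤ 2 * N) :
    FanTree (N + 1) (insert (2 * (N + 1)) (insert (2 * N + 1) T)) ↔
      2 * N ∉ T ∧ FanTree N (insert (2 * N) T) := by
  have h1 : 2 * N + 1 ∉ T := fun hx => by have := hT _ hx; omega
  have h2 : 2 * (N + 1) ∉ insert (2 * N + 1) T := fun hx => by
    have := hT _ (Finset.mem_of_mem_insert_of_ne hx (by omega)); omega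
  rw [FanTree, FanTree, fanConnected_succ_insert_spoke_rim,
    Finset.card_insert_of_notMem h2, Finset.card_insert_of_notMem h1]
  by_cases hN : 2 * N ∈ T
  · simp only [hN, not_true_eq_false, false_and, iff_false, not_and, Finset.insert_eq_of_mem]
    intro h hc
    have := h.succ_le_card hT
    omega
  · simp only [hN, not_false_eq_true, true_and, Finset.card_insert_of_notMem,
      Nat.add_right_cancel_iff]

end FanConnected

open Classical in
/-- The unmarked edges of the fan with rim `0, …, N`: all rim edges, and the spokes to the rim
vertices `j < N` with `j ∈ S`. -/
noncomputable def fanEdges (S : Finset ℕ) : ℕ → Finset ℕ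
  | 0 => ∅
  | N + 1 => insert (2 * N + 1) (if N ∈ S then insert (2 * N) (fanEdges S N) else fanEdges S N)

theorem lt_of_mem_fanEdges {S : Finset ℕ} {N x : ℕ} (hx : x ∈ fanEdges S N) : x < 2 * N := by
  induction N with
  | zero => simp [fanEdges] at hx
  | succ N ih =>
    rw [fanEdges] at hx
    split_ifs at hx <;> grind

theorem rim_mem_fanEdges {S : Finset ℕ} {N i : ℕ} (hi : i < N) : 2 * i + 1 ∈ fanEdges S N := by
  induction N with
  | zero => omega
  | succ N ih =>
    rw [fanEdges]
    split_ifs <;> grind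

theorem fanEdges_congr {S S' : Finset ℕ} {N : ℕ} (h : ∀ j < N, j ∈ S ↔ j ∈ S') :
    fanEdges S N = fanEdges S' N := by
  induction N with
  | zero => rfl
  | succ N ih =>
    rw [fanEdges, fanEdges, ih fun j hj => h j (by omega)]
    simp only [h N (by omega)]

open Classical in
/-- The number of spanning trees of the fan avoiding the marked spoke `2 * N`. -/
noncomputable def fanDel (S : Finset ℕ) (N : ℕ) : ℕ :=
  ∑ T ∈ (fanEdges S N).powerset, if FanTree N T then 1 else 0

open Classical in
/-- The number of spanning trees of the fan containing the marked spoke `2 * N`. -/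
noncomputable def fanCon (S : Finset ℕ) (N : ℕ) : ℕ :=
  ∑ T ∈ (fanEdges S N).powerset, if FanTree N (insert (2 * N) T) then 1 else 0

theorem fanDel_zero (S : Finset ℕ) : fanDel S 0 = 0 := by
  simp [fanDel, fanEdges, FanTree]

theorem fanCon_zero (S : Finset ℕ) : fanCon S 0 = 1 := by
  have : FanTree 0 {0} := ⟨fun j hj => ⟨0, le_rfl, by simp, fun i hi => by omega⟩, by simp⟩
  rw [fanCon, fanEdges, Finset.powerset_empty, Finset.sum_singleton]
  exact if_pos this

open Classical in
theorem sum_fanTree_powerset (S : Finset ℕ) (N : ℕ) :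
    (∑ T ∈ (if N ∈ S then insert (2 * N) (fanEdges S N) else fanEdges S N).powerset,
      if FanTree N T then 1 else 0) = fanDel S N + if N ∈ S then fanCon S N else 0 := by
  split_ifs
  · rw [Finset.sum_powerset_insert fun hx => by have := lt_of_mem_fanEdges hx; omega]
    rfl
  · rfl

open Classical in
theorem le_of_mem_powerset_fanEdges {S T : Finset ℕ} {N : ℕ}
    (hT : T ∈ (if N ∈ S then insert (2 * N) (fanEdges S N) else fanEdges S N).powerset) :
    ∀ x ∈ T, x ≤ 2 * N := by
  intro x hx
  have := Finset.mem_powerset.1 hT hx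
  have h := @lt_of_mem_fanEdges S N x
  split_ifs at this <;> grind

open Classical in
theorem fanDel_succ (S : Finset ℕ) (N : ℕ) :
    fanDel S (N + 1) = fanDel S N + if N ∈ S then fanCon S N else 0 := by
  rw [← sum_fanTree_powerset, fanDel, fanEdges, Finset.sum_powerset_insert,
    Finset.sum_eq_zero, zero_add]
  · refine Finset.sum_congr rfl fun T hT => ?_
    rw [fanTree_succ_insert_rim (le_of_mem_powerset_fanEdges hT)]
  · intro T hT
    rw [if_neg (not_fanTree_succ (le_of_mem_powerset_fanEdges hT))]
  · intro hx
    have := le_of_mem_powerset_fanEdges (Finset.mem_powerset_self _) _ hx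
    omega

open Classical in
theorem fanCon_succ (S : Finset ℕ) (N : ℕ) :
    fanCon S (N + 1) = fanDel S (N + 1) + fanCon S N := by
  rw [fanDel_succ, ← sum_fanTree_powerset, fanCon, fanEdges, Finset.sum_powerset_insert]
  · congr 1
    · refine Finset.sum_congr rfl fun T hT => ?_
      rw [fanTree_succ_insert_spoke (le_of_mem_powerset_fanEdges hT)]
    · have hN : 2 * N ∉ fanEdges S N := fun hx => by have := lt_of_mem_fanEdges hx; omega
      have key : ∀ T ∈ (if N ∈ S then insert (2 * N) (fanEdges S N) else fanEdges S N).powerset,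
          (if FanTree (N + 1) (insert (2 * (N + 1)) (insert (2 * N + 1) T)) then 1 else 0) =
            if 2 * N ∉ T ∧ FanTree N (insert (2 * N) T) then 1 else 0 := fun T hT => by
        simp only [fanTree_succ_insert_spoke_rim (le_of_mem_powerset_fanEdges hT)]
      rw [Finset.sum_congr rfl key, fanCon]
      have h0 : (∑ T ∈ (fanEdges S N).powerset,
          if 2 * N ∉ T ∧ FanTree N (insert (2 * N) T) then 1 else 0) =
          ∑ T ∈ (fanEdges S N).powerset, if FanTree N (insert (2 * N) T) then 1 else 0 := by
        refine Finset.sum_congr rfl fun T hT => ?_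
        have : 2 * N ∉ T := fun h => hN (Finset.mem_powerset.1 hT h)
        simp only [this, not_false_eq_true, true_and]
      split_ifs
      · rw [Finset.sum_powerset_insert hN, h0]
        simp
      · exact h0
  · intro hx
    have := le_of_mem_powerset_fanEdges (Finset.mem_powerset_self _) _ hx
    omega

theorem fanDel_congr {S S' : Finset ℕ} {N : ℕ} (h : ∀ j < N, j ∈ S ↔ j ∈ S') :
    fanDel S N = fanDel S' N := by
  rw [fanDel, fanDel, fanEdges_congr h]

theorem fanCon_congr {S S' : Finset ℕ} {N : ℕ} (h : ∀ j < N, j ∈ S ↔ j ∈ S') :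
    fanCon S N = fanCon S' N := by
  rw [fanCon, fanCon, fanEdges_congr h]

/-- The rim vertices carrying an unmarked spoke in the fan built from the list `B`. -/
def fanSpokes : List ℕ → Finset ℕ
  | [] => ∅
  | _ :: l => insert l.sum (fanSpokes l)

theorem lt_sum_of_mem_fanSpokes {B : List ℕ} (hpos : ∀ b ∈ B, 0 < b) {j : ℕ}
    (hj : j ∈ fanSpokes B) : j < B.sum := by
  induction B with
  | nil => simp [fanSpokes] at hj
  | cons b l ih =>
    have hb := hpos b (by simp)
    have := ih fun x hx => hpos x (by simp [hx])
    rw [fanSpokes, Finset.mem_insert] at hj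
    rw [List.sum_cons]
    grind

theorem fan_cons (b : ℕ) (l : List ℕ) (hpos : ∀ x ∈ l, 0 < x) :
    fanDel (insert l.sum (fanSpokes l)) (l.sum + (b + 1)) =
      fanDel (fanSpokes l) l.sum + fanCon (fanSpokes l) l.sum ∧
    fanCon (insert l.sum (fanSpokes l)) (l.sum + (b + 1)) = fanCon (fanSpokes l) l.sum +
      (b + 1) * (fanDel (fanSpokes l) l.sum + fanCon (fanSpokes l) l.sum) := by
  have hS : ∀ j < l.sum, j ∈ insert l.sum (fanSpokes l) ↔ j ∈ fanSpokes l := by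
    intro j hj
    simp [hj.ne]
  induction b with
  | zero =>
    rw [zero_add, fanCon_succ, fanDel_succ, if_pos (Finset.mem_insert_self _ _),
      fanDel_congr hS, fanCon_congr hS]
    exact ⟨rfl, by ring⟩
  | succ b ih =>
    obtain ⟨h1, h2⟩ := ih
    have h : l.sum + (b + 1) ∉ insert l.sum (fanSpokes l) := by
      intro hx
      rcases Finset.mem_insert.1 hx with hx | hx
      · omega
      · have := lt_sum_of_mem_fanSpokes hpos hx
        omega
    rw [← add_assoc, fanCon_succ, fanDel_succ, if_neg h, add_zero, h1, h2]
    exact ⟨rfl, by ring⟩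

theorem fan_contFrac (B : List ℕ) (hpos : ∀ b ∈ B, 0 < b) :
    0 < fanCon (fanSpokes B) B.sum ∧
    (fanDel (fanSpokes B) B.sum).Coprime (fanCon (fanSpokes B) B.sum) ∧
    contFrac (altList B) = fanDel (fanSpokes B) B.sum / fanCon (fanSpokes B) B.sum := by
  induction B with
  | nil => simp [fanDel_zero, fanCon_zero, contFrac, altList]
  | cons b l ih =>
    have hl : ∀ x ∈ l, 0 < x := fun x hx => hpos x (by simp [hx])
    obtain ⟨h1, h2, h3⟩ := ih hl
    obtain ⟨b, rfl⟩ := Nat.exists_eq_add_of_lt (hpos b (by simp))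
    rw [zero_add] at *
    obtain ⟨h4, h5⟩ := fan_cons b l hl
    rw [fanSpokes, List.sum_cons, add_comm (b + 1) l.sum, h4, h5, altList, contFrac, contFrac, h3]
    refine ⟨by positivity, ?_, ?_⟩
    · simpa using h2
    · have : (0 : ℚ) < fanCon (fanSpokes l) l.sum := by exact_mod_cast h1
      push_cast
      field_simp
      ring

section Planarity

variable {n : ℕ} {G : SimpleGraph (Fin n)} {hub : Fin n}

theorem mem_of_induce_connected
    (hG : ∀ u v, G.Adj u v → u ≠ hub → v ≠ hub → u.1 + 1 = v.1 ∨ v.1 + 1 = u.1)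
    {A : Set (Fin n)} (hA : (G.induce A).Connected) (hub_notMem : hub ∉ A) {x y z : Fin n}
    (hx : x ∈ A) (hz : z ∈ A) (hxy : x < y) (hyz : y < z) : y ∈ A := by
  by_contra hy
  have key : ∀ w : A, Relation.ReflTransGen (G.induce A).Adj ⟨x, hx⟩ w → w.1 < y := by
    intro w hw
    induction hw with
    | refl => exact hxy
    | @tail v w _ hvw ih =>
      have h1 := hG v w hvw (fun h => hub_notMem (h ▸ v.2)) (fun h => hub_notMem (h ▸ w.2))
      have h2 : w.1 ≠ y := fun h => hy (h ▸ w.2)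
      rw [Fin.lt_def] at *
      have h3 := Fin.val_ne_of_ne h2
      omega
  have := key ⟨z, hz⟩ ((SimpleGraph.reachable_iff_reflTransGen _ _).1 (hA.preconnected _ _))
  exact lt_asymm hyz this

/-- Away from the hub the graph is a path, so it has no claw minor. -/
theorem no_claw_of_path
    (hG : ∀ u v, G.Adj u v → u ≠ hub → v ≠ hub → u.1 + 1 = v.1 ∨ v.1 + 1 = u.1)
    {W : Type} {f : W → Set (Fin n)} (hc : ∀ w, (G.induce (f w)).Connected)
    (hd : Pairwise fun w₁ w₂ => Disjoint (f w₁) (f w₂)) {w₀ : W} {w : Fin 3 → W}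
    (hw : Function.Injective w) (hne : ∀ i, w i ≠ w₀)
    (hadj : ∀ i, ∃ a ∈ f w₀, ∃ b ∈ f (w i), G.Adj a b)
    (hub₀ : hub ∉ f w₀) (hub₁ : ∀ i, hub ∉ f (w i)) : False := by
  choose a ha b hb hab using hadj
  have hbA : ∀ i, b i ∉ f w₀ := fun i h => Set.disjoint_left.1 (hd (hne i)) (hb i) h
  have hbb : ∀ i j, i ≠ j → (b i).1 ≠ (b j).1 := fun i j hij h =>
    Set.disjoint_left.1 (hd (hw.ne hij)) (hb i) (Fin.ext h ▸ hb j)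
  have hstep : ∀ i, (a i).1 + 1 = (b i).1 ∨ (b i).1 + 1 = (a i).1 := fun i =>
    hG _ _ (hab i) (fun h => hub₀ (h ▸ ha i)) (fun h => hub₁ i (h ▸ hb i))
  have hconv : ∀ i j k, ¬ ((a j).1 < (b i).1 ∧ (b i).1 < (a k).1) := fun i j k h =>
    hbA i (mem_of_induce_connected hG (hc w₀) hub₀ (ha j) (ha k) h.1 h.2)
  have hne' : ∀ i j, (b i).1 ≠ (a j).1 := fun i j h => hbA i (Fin.ext h ▸ ha j)
  have key : ∀ i j, i ≠ j → ¬ ((a i).1 < (b i).1 ↔ (a j).1 < (b j).1) := by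
    intro i j hij h
    have h1 := hstep i
    have h2 := hstep j
    have h3 := hconv i i j
    have h4 := hconv j j i
    have h5 := hconv i j i
    have h6 := hconv j i j
    have h7 := hbb i j hij
    have h8 := hne' i j
    have h9 := hne' j i
    omega
  have h01 := key 0 1 (by decide)
  have h02 := key 0 2 (by decide)
  have h12 := key 1 2 (by decide)
  tauto

theorem exists_forall_ne_notMem {W V : Type} [Nonempty W] {f : W → Set V}
    (hd : Pairwise fun w₁ w₂ => Disjoint (f w₁) (f w₂)) (v : V) : ∃ c, ∀ w ≠ c, v ∉ f w := by
  by_cases h : ∃ c, v ∈ f c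
  · obtain ⟨c, hc⟩ := h
    exact ⟨c, fun w hw hv => Set.disjoint_left.1 (hd hw) hv hc⟩
  · exact ⟨Classical.arbitrary W, fun w _ hv => h ⟨w, hv⟩⟩

theorem isPlanar_of_path_add_hub
    (hG : ∀ u v, G.Adj u v → u ≠ hub → v ≠ hub → u.1 + 1 = v.1 ∨ v.1 + 1 = u.1) :
    G.IsPlanar := by
  constructor
  · rintro ⟨f, hc, hd, ha⟩
    obtain ⟨c, hhub⟩ := exists_forall_ne_notMem hd hub
    have key : ∀ c : Fin 5,
        (Function.Injective fun i : Fin 3 => c + 2 + Fin.castLE (by omega : 3 ≤ 5) i) ∧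
        c + 1 ≠ c ∧ (∀ i : Fin 3, c + 2 + Fin.castLE (by omega : 3 ≤ 5) i ≠ c) ∧
        ∀ i : Fin 3, c + 2 + Fin.castLE (by omega : 3 ≤ 5) i ≠ c + 1 := by decide
    obtain ⟨hinj, h1, h2, h3⟩ := key c
    exact no_claw_of_path hG hc hd hinj h3 (fun i => ha _ _ (h3 i).symm) (hhub _ h1)
      fun i => hhub _ (h2 i)
  · rintro ⟨f, hc, hd, ha⟩
    obtain ⟨c, hhub⟩ := exists_forall_ne_notMem hd hub
    rcases c with c | c
    · exact no_claw_of_path hG hc hd (w₀ := .inl (c + 1)) (w := .inr) Sum.inr_injective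
        (by simp) (fun i => ha _ _ (by simp)) (hhub _ (by simp))
        fun i => hhub _ (by simp)
    · exact no_claw_of_path hG hc hd (w₀ := .inr (c + 1)) (w := .inl) Sum.inl_injective
        (by simp) (fun i => ha _ _ (by simp)) (hhub _ (by simp))
        fun i => hhub _ (by simp)

end Planarity

namespace Multigraph

variable {V E : Type}

theorem simpleOf_adj {M : Multigraph V E} {T : Set E} {u v : V} :
    (M.simpleOf T).Adj u v ↔ ∃ e ∈ T, s(u, v) = s(M.fst e, M.snd e) := by
  rw [simpleOf, SimpleGraph.fromEdgeSet_adj, Set.mem_ofPred_eq, and_iff_left_iff_imp]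
  rintro ⟨e, -, he⟩ rfl
  have := M.no_loop e
  grind

theorem simpleOf_adj_of_mem {M : Multigraph V E} {T : Set E} {e : E} (he : e ∈ T) :
    (M.simpleOf T).Adj (M.fst e) (M.snd e) :=
  simpleOf_adj.2 ⟨e, he, rfl⟩

theorem simpleOf_delete (M : Multigraph V E) (e : E) (T' : Set {e' : E // e' ≠ e}) :
    (M.delete e).simpleOf T' = M.simpleOf (Subtype.val '' T') := by
  ext u v
  rw [simpleOf_adj, simpleOf_adj, Set.exists_mem_image]
  rfl

theorem contractMap_val_eq (M : Multigraph V E) {e : E} (w : {w : V // w ≠ M.snd e}) :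
    M.contractMap e w.1 = w := by
  rw [contractMap, dif_neg w.2]

theorem contractMap_fst (M : Multigraph V E) (e : E) :
    M.contractMap e (M.fst e) = M.contractMap e (M.snd e) := by
  rw [contractMap, contractMap, dif_neg (M.no_loop e), dif_pos rfl]

theorem Simple.contractMap_ne {M : Multigraph V E} (hM : M.Simple) {e e' : E} (h : e' ≠ e) :
    M.contractMap e (M.fst e') ≠ M.contractMap e (M.snd e') := by
  intro hc
  have h1 := M.no_loop e'
  have h2 := mt (hM e' e) h
  unfold contractMap at hc
  split_ifs at hc <;> grind

theorem connected_contract_iff (M : Multigraph V E) {e : E}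
    {T' : Set {e' : E // e' ≠ e ∧ M.contractMap e (M.fst e') ≠ M.contractMap e (M.snd e')}}
    {T : Set E} (hT : ∀ x, x ∈ T ↔ x = e ∨ ∃ h, ⟨x, h⟩ ∈ T') :
    ((M.contract e).simpleOf T').Connected ↔ (M.simpleOf T).Connected := by
  have he : (M.simpleOf T).Adj (M.fst e) (M.snd e) := simpleOf_adj_of_mem ((hT e).2 (.inl rfl))
  have hmap : ∀ v, (M.simpleOf T).Reachable v (M.contractMap e v) := by
    intro v
    rw [contractMap]
    split_ifs with h
    · rw [h]
      exact he.symm.reachable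
    · rfl
  constructor
  · intro h
    have hlift : ∀ x y, Relation.ReflTransGen ((M.contract e).simpleOf T').Adj x y →
        (M.simpleOf T).Reachable x.1 y.1 := by
      intro x y hxy
      induction hxy with
      | refl => rfl
      | tail _ hyz ih =>
        obtain ⟨e', he', hs⟩ := simpleOf_adj.1 hyz
        have h1 : (M.simpleOf T).Reachable (M.contractMap e (M.fst e'.1)).1
            (M.contractMap e (M.snd e'.1)).1 :=
          (hmap _).symm.trans ((simpleOf_adj_of_mem ((hT _).2 (.inr ⟨e'.2, he'⟩))).reachable.trans
            (hmap _))
        refine ih.trans ?_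
        rcases Sym2.eq_iff.1 hs with ⟨rfl, rfl⟩ | ⟨rfl, rfl⟩
        · exact h1
        · exact h1.symm
    refine SimpleGraph.connected_iff _ |>.2 ⟨fun u v => ?_, ⟨M.fst e⟩⟩
    exact (hmap u).trans ((hlift _ _ ((SimpleGraph.reachable_iff_reflTransGen _ _).1
      (h.preconnected _ _))).trans (hmap v).symm)
  · intro h
    have hproj : ∀ u v, Relation.ReflTransGen (M.simpleOf T).Adj u v →
        ((M.contract e).simpleOf T').Reachable (M.contractMap e u) (M.contractMap e v) := by
      intro u v huv
      induction huv with
      | refl => rfl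
      | tail _ hvw ih =>
        obtain ⟨x, hx, hs⟩ := simpleOf_adj.1 hvw
        have h1 : ((M.contract e).simpleOf T').Reachable (M.contractMap e (M.fst x))
            (M.contractMap e (M.snd x)) := by
          rcases (hT x).1 hx with rfl | ⟨hx', hxT⟩
          · rw [contractMap_fst]
          · exact (simpleOf_adj_of_mem (M := M.contract e) hxT).reachable
        refine ih.trans ?_
        rcases Sym2.eq_iff.1 hs with ⟨rfl, rfl⟩ | ⟨rfl, rfl⟩
        · exact h1
        · exact h1.symm
    refine SimpleGraph.connected_iff _ |>.2 ⟨fun u v => ?_, ⟨M.contractMap e (M.fst e)⟩⟩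
    rw [← M.contractMap_val_eq u, ← M.contractMap_val_eq v]
    exact hproj _ _ ((SimpleGraph.reachable_iff_reflTransGen _ _).1 (h.preconnected _ _))

theorem tau_eq_sum (M : Multigraph V E) {φ : E → ℕ} (hφ : Function.Injective φ) {F : Finset ℕ}
    (hF : Set.range φ = F) {P : Finset ℕ → Prop} [DecidablePred P]
    (h : ∀ T ⊆ F, M.IsSpanningTree (φ ⁻¹' T) ↔ P T) :
    M.tau = ∑ T ∈ F.powerset, if P T then 1 else 0 := by
  have hr : ∀ T ∈ F.powerset.filter P, (T : Set ℕ) ⊆ Set.range φ := fun T hT => by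
    rw [hF]
    exact_mod_cast Finset.mem_powerset.1 (Finset.mem_filter.1 hT).1
  let f : F.powerset.filter P → {T : Set E // M.IsSpanningTree T} := fun T =>
    ⟨φ ⁻¹' (T.1 : Set ℕ), (h T.1 (Finset.mem_powerset.1 (Finset.mem_filter.1 T.2).1)).2
      (Finset.mem_filter.1 T.2).2⟩
  have hf : Function.Bijective f := by
    constructor
    · intro T₁ T₂ h12
      have h12 : φ ⁻¹' (T₁.1 : Set ℕ) = φ ⁻¹' (T₂.1 : Set ℕ) := congrArg Subtype.val h12
      rw [Set.preimage_eq_preimage' (hr _ T₁.2) (hr _ T₂.2)] at h12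
      exact Subtype.ext (Finset.coe_injective h12)
    · rintro ⟨T, hT⟩
      have hsub : φ '' T ⊆ F := hF ▸ Set.image_subset_range φ T
      obtain ⟨T', hT'⟩ := (F.finite_toSet.subset hsub).exists_finset_coe
      have hpre : φ ⁻¹' (T' : Set ℕ) = T := by rw [hT', Set.preimage_image_eq _ hφ]
      have hsub' : T' ⊆ F := by rw [← hT'] at hsub; exact_mod_cast hsub
      have hP : P T' := (h T' hsub').1 (by rwa [hpre])
      exact ⟨⟨T', Finset.mem_filter.2 ⟨Finset.mem_powerset.2 hsub', hP⟩⟩, Subtype.ext hpre⟩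
  rw [← Finset.card_filter, tau, ← Nat.card_congr (Equiv.ofBijective f hf),
    Nat.card_eq_fintype_card, Fintype.card_coe]

end Multigraph

open Multigraph

/-- The fan with rim `0, …, N`, hub `N + 1` and edge set `F`, coded as in `FanLinked`. -/
def fan (N : ℕ) (F : Finset ℕ) (hF : ∀ x ∈ F, x ≤ 2 * N) :
    Multigraph (Fin (N + 2)) {x // x ∈ F} where
  fst x := ⟨if x.1 % 2 = 0 then N + 1 else x.1 / 2, by have := hF _ x.2; split_ifs <;> omega⟩
  snd x := ⟨(x.1 + 1) / 2, by have := hF _ x.2; omega⟩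
  no_loop x h := by
    have := hF _ x.2
    rw [Fin.mk.injEq] at h
    split_ifs at h <;> omega

section Fan

variable {N : ℕ} {F : Finset ℕ} (hF : ∀ x ∈ F, x ≤ 2 * N)

theorem fan_simple : (fan N F hF).Simple := by
  intro x y h
  have hx := hF _ x.2
  have hy := hF _ y.2
  simp only [fan, Sym2.eq_iff, Fin.mk.injEq] at h
  apply Subtype.ext
  split_ifs at h <;> omega

theorem fan_adj {T : Set {x // x ∈ F}} {u v : Fin (N + 2)}
    (h : ((fan N F hF).simpleOf T).Adj u v) :
    ∃ x ∈ T, (∃ k ≤ N, x.1 = 2 * k ∧ (u.1 = N + 1 ∧ v.1 = k ∨ u.1 = k ∧ v.1 = N + 1)) ∨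
      ∃ i < N, x.1 = 2 * i + 1 ∧ (u.1 = i ∧ v.1 = i + 1 ∨ u.1 = i + 1 ∧ v.1 = i) := by
  obtain ⟨x, hx, hs⟩ := simpleOf_adj.1 h
  have hxN := hF _ x.2
  refine ⟨x, hx, ?_⟩
  simp only [fan, Sym2.eq_iff, Fin.ext_iff] at hs
  split_ifs at hs
  · exact .inl ⟨x.1 / 2, by omega, by omega, by omega⟩
  · exact .inr ⟨x.1 / 2, by omega, by omega, by omega⟩

theorem fan_isPlanar (T : Set {x // x ∈ F}) : ((fan N F hF).simpleOf T).IsPlanar := by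
  refine isPlanar_of_path_add_hub (hub := Fin.last (N + 1)) fun u v huv hu hv => ?_
  have hu := Fin.val_ne_of_ne hu
  have hv := Fin.val_ne_of_ne hv
  rw [Fin.val_last] at hu hv
  obtain ⟨x, -, ⟨k, -, -, h⟩ | ⟨i, -, -, h⟩⟩ := fan_adj hF huv <;> omega

theorem fan_adj_spoke {T : Set {x // x ∈ F}} {k : ℕ} (hk : k ≤ N)
    (h : ∃ hx : 2 * k ∈ F, ⟨2 * k, hx⟩ ∈ T) :
    ((fan N F hF).simpleOf T).Adj (Fin.last (N + 1)) ⟨k, by omega⟩ := by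
  obtain ⟨hx, hT⟩ := h
  convert simpleOf_adj_of_mem (M := fan N F hF) hT using 1
  · simp [fan, Fin.ext_iff]
  · simp only [fan, Fin.ext_iff]; omega

theorem fan_adj_rim {T : Set {x // x ∈ F}} {i : ℕ} (hi : i < N)
    (h : ∃ hx : 2 * i + 1 ∈ F, ⟨2 * i + 1, hx⟩ ∈ T) :
    ((fan N F hF).simpleOf T).Adj ⟨i, by omega⟩ ⟨i + 1, by omega⟩ := by
  obtain ⟨hx, hT⟩ := h
  convert simpleOf_adj_of_mem (M := fan N F hF) hT using 1
  · simp only [fan, Fin.ext_iff]; split_ifs <;> omega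
  · simp only [fan, Fin.ext_iff]; omega

theorem fan_reachable_rim {T : Set {x // x ∈ F}} {a : ℕ} (d : ℕ) (hd : a + d ≤ N)
    (h : ∀ i, a ≤ i → i < a + d → ∃ hx : 2 * i + 1 ∈ F, ⟨2 * i + 1, hx⟩ ∈ T) :
    ((fan N F hF).simpleOf T).Reachable ⟨a, by omega⟩ ⟨a + d, by omega⟩ := by
  induction d with
  | zero => rfl
  | succ d ih =>
    exact (ih (by omega) fun i h1 h2 => h i h1 (by omega)).trans
      (fan_adj_rim hF (i := a + d) (by omega) (h _ (by omega) (by omega))).reachable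

theorem fan_connected_iff {T : Finset ℕ} (hT : T ⊆ F) :
    ((fan N F hF).simpleOf (Subtype.val ⁻¹' (T : Set ℕ))).Connected ↔ FanConnected N T := by
  constructor
  · intro h
    have key : ∀ v, Relation.ReflTransGen
        ((fan N F hF).simpleOf (Subtype.val ⁻¹' (T : Set ℕ))).Adj (Fin.last (N + 1)) v →
        v.1 = N + 1 ∨ FanLinked N T v.1 := by
      intro v hv
      induction hv with
      | refl => exact .inl rfl
      | @tail u v _ huv ih =>
        obtain ⟨⟨x, hxF⟩, hx, ⟨k, hk, hxk, h⟩ | ⟨i, hi, hxi, h⟩⟩ := fan_adj hF huv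
        · obtain rfl : x = 2 * k := hxk
          rcases h with ⟨-, hv⟩ | ⟨-, hv⟩
          · exact .inr ⟨k, hk, hx, fun i hi => by omega⟩
          · exact .inl hv
        · obtain rfl : x = 2 * i + 1 := hxi
          obtain ⟨k, hk, hkT, hp⟩ := ih.resolve_left (by omega)
          refine .inr ⟨k, hk, hkT, fun i' hi' => ?_⟩
          by_cases hii : i' = i
          · exact hii ▸ hx
          · exact hp i' (by omega)
    intro j hj
    have := key ⟨j, by omega⟩
      ((SimpleGraph.reachable_iff_reflTransGen _ _).1 (h.preconnected _ _))
    exact this.resolve_left (by simp; omega)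
  · intro h
    rw [SimpleGraph.connected_iff_exists_forall_reachable]
    refine ⟨Fin.last (N + 1), fun v => ?_⟩
    by_cases hv : v.1 = N + 1
    · rw [show v = Fin.last (N + 1) from Fin.ext hv]
    · obtain ⟨k, hk, hkT, hp⟩ := h v.1 (by omega)
      refine (fan_adj_spoke hF hk ⟨hT hkT, hkT⟩).reachable.trans ?_
      rcases le_total k v.1 with hkv | hkv
      · have := fan_reachable_rim hF (T := Subtype.val ⁻¹' (T : Set ℕ)) (a := k) (v.1 - k)
          (by omega) fun i h1 h2 => ⟨hT (hp i (by omega)), hp i (by omega)⟩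
        convert this using 1
        simp only [Fin.ext_iff]; omega
      · have := fan_reachable_rim hF (T := Subtype.val ⁻¹' (T : Set ℕ)) (a := v.1) (k - v.1)
          (by omega) fun i h1 h2 => ⟨hT (hp i (by omega)), hp i (by omega)⟩
        convert this.symm using 1
        simp only [Fin.ext_iff]; omega

end Fan

section Tau

variable {S : Finset ℕ} {N : ℕ} (hF : ∀ x ∈ insert (2 * N) (fanEdges S N), x ≤ 2 * N)

open Classical in
theorem tau_delete_fan :
    ((fan N _ hF).delete ⟨2 * N, Finset.mem_insert_self _ _⟩).tau = fanDel S N := by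
  have hφ : Function.Injective
      fun x : {e' : {x // x ∈ insert (2 * N) (fanEdges S N)} //
        e' ≠ ⟨2 * N, Finset.mem_insert_self _ _⟩} => x.1.1 :=
    Subtype.val_injective.comp Subtype.val_injective
  have hr : Set.range (fun x : {e' : {x // x ∈ insert (2 * N) (fanEdges S N)} //
      e' ≠ ⟨2 * N, Finset.mem_insert_self _ _⟩} => x.1.1) = fanEdges S N := by
    ext x
    constructor
    · rintro ⟨⟨⟨x, hx⟩, hne⟩, rfl⟩
      exact Finset.mem_of_mem_insert_of_ne hx fun h => hne (Subtype.ext h)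
    · intro hx
      have := lt_of_mem_fanEdges hx
      exact ⟨⟨⟨x, Finset.mem_insert_of_mem hx⟩, fun h => this.ne (congrArg Subtype.val h)⟩, rfl⟩
  refine tau_eq_sum _ hφ hr fun T hT => ?_
  have hcard := Set.ncard_preimage_of_injective_subset_range hφ
    (s := (T : Set ℕ)) (by rw [hr]; exact_mod_cast hT)
  rw [IsSpanningTree, hcard, Set.ncard_coe_finset, Nat.card_fin, FanTree,
    simpleOf_delete, ← fan_connected_iff hF (hT.trans (Finset.subset_insert _ _))]
  have himage : Subtype.val '' ((fun x : {e' : {x // x ∈ insert (2 * N) (fanEdges S N)} //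
      e' ≠ ⟨2 * N, Finset.mem_insert_self _ _⟩} => x.1.1) ⁻¹' (T : Set ℕ)) =
      Subtype.val ⁻¹' (T : Set ℕ) := by
    ext x
    constructor
    · rintro ⟨y, hy, rfl⟩
      exact hy
    · intro hx
      have := lt_of_mem_fanEdges (hT hx)
      exact ⟨⟨x, fun h => this.ne (congrArg Subtype.val h)⟩, hx, rfl⟩
  rw [himage]
  rfl

open Classical in
theorem tau_contract_fan :
    ((fan N _ hF).contract ⟨2 * N, Finset.mem_insert_self _ _⟩).tau = fanCon S N := by
  set e : {x // x ∈ insert (2 * N) (fanEdges S N)} := ⟨2 * N, Finset.mem_insert_self _ _⟩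
  set M := fan N _ hF
  have hφ : Function.Injective fun x : {e' // e' ≠ e ∧
      M.contractMap e (M.fst e') ≠ M.contractMap e (M.snd e')} => x.1.1 :=
    Subtype.val_injective.comp Subtype.val_injective
  have hr : Set.range (fun x : {e' // e' ≠ e ∧
      M.contractMap e (M.fst e') ≠ M.contractMap e (M.snd e')} => x.1.1) = fanEdges S N := by
    ext x
    constructor
    · rintro ⟨⟨⟨x, hx⟩, hne, -⟩, rfl⟩
      exact Finset.mem_of_mem_insert_of_ne hx fun h => hne (Subtype.ext h)
    · intro hx
      have := lt_of_mem_fanEdges hx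
      have hne : (⟨x, Finset.mem_insert_of_mem hx⟩ :
          {x // x ∈ insert (2 * N) (fanEdges S N)}) ≠ e :=
        fun h => this.ne (congrArg Subtype.val h)
      exact ⟨⟨_, hne, (fan_simple hF).contractMap_ne hne⟩, rfl⟩
  refine tau_eq_sum _ hφ hr fun T hT => ?_
  have hcard := Set.ncard_preimage_of_injective_subset_range hφ
    (s := (T : Set ℕ)) (by rw [hr]; exact_mod_cast hT)
  have hV : Nat.card {w : Fin (N + 2) // w ≠ M.snd e} = N + 1 := by
    rw [Nat.card_eq_fintype_card, Fintype.card_subtype_compl, Fintype.card_fin,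
      Fintype.card_subtype_eq]
    omega
  have hN : 2 * N ∉ T := fun h => (lt_of_mem_fanEdges (hT h)).ne rfl
  have hiff := connected_contract_iff M (e := e)
    (T' := (fun x : {e' // e' ≠ e ∧
      M.contractMap e (M.fst e') ≠ M.contractMap e (M.snd e')} => x.1.1) ⁻¹' (T : Set ℕ))
    (T := Subtype.val ⁻¹' ((insert (2 * N) T : Finset ℕ) : Set ℕ)) fun x => by
      rw [Set.mem_preimage, Finset.mem_coe, Finset.mem_insert]
      refine or_congr (Subtype.ext_iff (a1 := x) (a2 := e)).symm ⟨fun hx => ?_, fun ⟨_, hx⟩ => hx⟩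
      have hne : x ≠ e := fun h => hN (by rw [h] at hx; exact hx)
      exact ⟨⟨hne, (fan_simple hF).contractMap_ne hne⟩, hx⟩
  rw [IsSpanningTree, hcard, Set.ncard_coe_finset, hV, FanTree,
    Finset.card_insert_of_notMem hN, ← fan_connected_iff hF (Finset.insert_subset_insert _ hT),
    Nat.add_sub_cancel, Nat.add_right_cancel_iff]
  exact and_congr_left' hiff

end Tau

/-- If coprime `t ≤ u` satisfy `t/u = [b₁,1,b₂,1,…,b_m,1]` with all `bᵢ ≥ 1`, then there is
a connected simple planar graph `G` on `b₁ + ⋯ + b_m + 2` vertices with a marked edge `e`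
such that `τ(G − e) = t` and `τ(G/e) = u`. -/
theorem marked_graph_from_contFrac (t u : ℕ) (ht : 0 < t) (htu : t ≤ u)
    (hcop : Nat.Coprime t u) (B : List ℕ) (hB : B ≠ []) (hpos : ∀ b ∈ B, 0 < b)
    (hcf : (t : ℚ) / (u : ℚ) = contFrac (altList B)) :
    ∃ (E : Type) (_ : Fintype E) (M : Multigraph (Fin (B.sum + 2)) E) (e : E),
      M.Simple ∧ (M.simpleOf Set.univ).Connected ∧ (M.simpleOf Set.univ).IsPlanar ∧
      (M.delete e).tau = t ∧ (M.contract e).tau = u := by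
  obtain ⟨hpos', hcop', hfrac⟩ := fan_contFrac B hpos
  have hF : ∀ x ∈ insert (2 * B.sum) (fanEdges (fanSpokes B) B.sum), x ≤ 2 * B.sum := by
    intro x hx
    rcases Finset.mem_insert.1 hx with rfl | hx
    · rfl
    · exact (lt_of_mem_fanEdges hx).le
  rw [hfrac] at hcf
  obtain ⟨h1, h2⟩ := Rat.div_int_inj (a := t) (b := u) (c := fanDel (fanSpokes B) B.sum)
    (d := fanCon (fanSpokes B) B.sum) (by exact_mod_cast ht.trans_le htu)
    (by exact_mod_cast hpos') hcop hcop' (by simpa only [Int.cast_natCast] using hcf)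
  refine ⟨_, inferInstance, fan B.sum _ hF, ⟨2 * B.sum, Finset.mem_insert_self _ _⟩,
    fan_simple hF, ?_, fan_isPlanar hF _, ?_, ?_⟩
  · have hconn : FanConnected B.sum (insert (2 * B.sum) (fanEdges (fanSpokes B) B.sum)) :=
      fun j hj => ⟨B.sum, le_rfl, Finset.mem_insert_self _ _, fun i hi =>
        Finset.mem_insert_of_mem (rim_mem_fanEdges (by omega))⟩
    have := (fan_connected_iff hF subset_rfl).2 hconn
    rwa [show (Subtype.val ⁻¹' _ : Set {x // x ∈ insert (2 * B.sum) _}) = Set.univ from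
      Set.eq_univ_of_forall fun x => x.2] at this
  · rw [tau_delete_fan]
    exact_mod_cast h1.symm
  · rw [tau_contract_fan]
    exact_mod_cast h2.symm
end
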